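/- Let s > 0, 0 < σ < s, ℏ > 0, and let a, G ∈ A_s. Then for every integer j ≥ 1, the iterated Moyal commutator Ad_G^{♯ℏ,j}(a) belongs to A_{s−σ} and ‖Ad_G^{♯ℏ,j}(a)‖_{s−σ} ≤ (2^j ℏ^j j^{2j} / (e^{2j} σ^{2j} j!)) ‖a‖_s ‖G‖_s^j. -/

import Mathlib

open MeasureTheory Real Filter Topology
open scoped ENNReal BigOperators

noncomputable section

/-- Phase space ℝ^{2d} = (x, ξ). -/
abbrev Pd (d : ℕ) : Type := (Fin d → ℝ) × (Fin d → ℝ)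

/-- Euclidean inner product on phase space. -/
def dotP {d : ℕ} (w z : Pd d) : ℝ :=
  (∑ j, w.1 j * z.1 j) + ∑ j, w.2 j * z.2 j

/-- Euclidean norm on phase space. -/
def normP {d : ℕ} (z : Pd d) : ℝ :=
  Real.sqrt ((∑ j, (z.1 j) ^ 2) + ∑ j, (z.2 j) ^ 2)

/-- Fourier transform  â(w) = ∫ e^{-i w·z} a(z) dz. -/
def fourierT {d : ℕ} (a : Pd d → ℂ) (w : Pd d) : ℂ :=
  ∫ z : Pd d, Complex.exp (-(Complex.I * (dotP w z))) * a z

/-- The analytic norm ‖a‖_s = ∫ |â(w)| e^{s‖w‖} dw  (with values in ℝ≥0∞). -/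
def Anorm {d : ℕ} (s : ℝ) (a : Pd d → ℂ) : ℝ≥0∞ :=
  ∫⁻ w : Pd d, ENNReal.ofReal (‖fourierT a w‖ * Real.exp (s * normP w))

/-- Membership in the space A_s : integrable with finite ‖·‖_s norm. -/
def MemAs {d : ℕ} (s : ℝ) (a : Pd d → ℂ) : Prop :=
  Integrable a ∧ Anorm s a < ⊤

instance fact2pi : Fact (0 < 2 * Real.pi) := ⟨Real.two_pi_pos⟩

/-- The circle ℝ/2πℤ. -/
abbrev Circle2pi : Type := AddCircle (2 * Real.pi)

/-- The torus 𝕋^d = ℝ^d/2πℤ^d. -/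
abbrev Torus (d : ℕ) : Type := Fin d → Circle2pi

/-- Cosine on the circle. -/
def aCos : Circle2pi → ℝ := Real.cos_periodic.lift

/-- Sine on the circle. -/
def aSin : Circle2pi → ℝ := Real.sin_periodic.lift

/-- The torus action Φ_τ^H on phase space: rotation by angle τ_j in the (x_j, ξ_j)-plane. -/
def PhiT {d : ℕ} (τ : Torus d) (z : Pd d) : Pd d :=
  (fun j => aCos (τ j) * z.1 j + aSin (τ j) * z.2 j,
   fun j => -aSin (τ j) * z.1 j + aCos (τ j) * z.2 j)

/-- The one-parameter line t ↦ tω in the torus. -/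
def lineTorus {d : ℕ} (ω : Fin d → ℝ) (t : ℝ) : Torus d :=
  fun j => ((t * ω j : ℝ) : Circle2pi)

/-- The harmonic oscillator flow φ_t^H = Φ_{tω}^H. -/
def phiH {d : ℕ} (ω : Fin d → ℝ) (t : ℝ) (z : Pd d) : Pd d :=
  PhiT (lineTorus ω t) z

/-- G_ω : the closure in 𝕋^d of the orbit {tω}. -/
def Gomega {d : ℕ} (ω : Fin d → ℝ) : Set (Torus d) :=
  closure (Set.range (lineTorus ω))

/-- ν is the normalized Haar measure of the compact subgroup G_ω :
it is a probability measure, carried by G_ω, invariant under translation by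
elements of G_ω.  These properties determine it uniquely. -/
def IsHaarOnG {d : ℕ} (ω : Fin d → ℝ) (ν : Measure (Torus d)) : Prop :=
  IsProbabilityMeasure ν ∧ ν (Gomega ω)ᶜ = 0 ∧
    ∀ g ∈ Gomega ω, Measure.map (fun τ => g + τ) ν = ν

/-- The average ⟨a⟩ of a along the harmonic oscillator flow. -/
def avg {d : ℕ} (ν : Measure (Torus d)) (a : Pd d → ℂ) (z : Pd d) : ℂ :=
  ∫ τ, a (PhiT τ z) ∂ν

/-- The standard symplectic form ς((x,ξ),(y,η)) = ξ·y − x·η. -/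
def symp {d : ℕ} (w v : Pd d) : ℝ :=
  (∑ j, w.2 j * v.1 j) - ∑ j, w.1 j * v.2 j

/-- The Moyal product a ♯_ℏ b. -/
def moyal {d : ℕ} (ℏ : ℝ) (a b : Pd d → ℂ) (z : Pd d) : ℂ :=
  (((2 * Real.pi) ^ (4 * d) : ℝ) : ℂ)⁻¹ *
    ∫ p : Pd d × Pd d,
      fourierT a p.1 * fourierT b (p.2 - p.1) *
        Complex.exp (Complex.I * ℏ / 2 * (symp p.1 (p.2 - p.1) : ℝ)) *
        Complex.exp (Complex.I * (dotP p.2 z : ℝ))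

/-- The Moyal commutator [a,b]_ℏ = a ♯_ℏ b − b ♯_ℏ a. -/
def moyalComm {d : ℕ} (ℏ : ℝ) (a b : Pd d → ℂ) : Pd d → ℂ :=
  fun z => moyal ℏ a b z - moyal ℏ b a z

/-- Coordinate vector in the x_j direction. -/
def ex {d : ℕ} (j : Fin d) : Pd d := (Pi.single j 1, 0)

/-- Coordinate vector in the ξ_j direction. -/
def exi {d : ℕ} (j : Fin d) : Pd d := (0, Pi.single j 1)

/-- Directional derivative of a complex-valued symbol. -/
def pdC {d : ℕ} (v : Pd d) (f : Pd d → ℂ) (z : Pd d) : ℂ := fderiv ℝ f z v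

/-- The Poisson bracket {a,b} = Σ_j (∂_{ξ_j}a ∂_{x_j}b − ∂_{x_j}a ∂_{ξ_j}b). -/
def poisson {d : ℕ} (a b : Pd d → ℂ) (z : Pd d) : ℂ :=
  ∑ j, (pdC (exi j) a z * pdC (ex j) b z - pdC (ex j) a z * pdC (exi j) b z)

/-- Iterated Moyal adjoint Ad_G^{♯ℏ,j}(a). -/
def adM {d : ℕ} (ℏ : ℝ) (G : Pd d → ℂ) : ℕ → (Pd d → ℂ) → (Pd d → ℂ)
  | 0, a => a
  | j + 1, a => moyalComm ℏ G (adM ℏ G j a)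

/-- The j-th term of the series defining Ψ_t^{G,ℏ} a. -/
def psiTerm {d : ℕ} (t ℏ : ℝ) (G a : Pd d → ℂ) (j : ℕ) : Pd d → ℂ :=
  fun z => ((Complex.I * t / ℏ) ^ j / (j.factorial : ℂ)) * adM ℏ G j a z

/-- Ψ_t^{G,ℏ} a = Σ_j (1/j!)(it/ℏ)^j Ad_G^{♯ℏ,j}(a). -/
def Psi {d : ℕ} (t ℏ : ℝ) (G a : Pd d → ℂ) (z : Pd d) : ℂ :=
  ∑' j : ℕ, psiTerm t ℏ G a j z
open scoped FourierTransform SchwartzMap ContDiff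


/-- Fourier inversion almost everywhere, for an integrable function with integrable Fourier
transform. -/
theorem ae_fourierInv_fourier_eq {V : Type*} [NormedAddCommGroup V] [InnerProductSpace ℝ V]
    [MeasurableSpace V] [BorelSpace V] [FiniteDimensional ℝ V] {f : V → ℂ}
    (hf : Integrable f) (hf' : Integrable (𝓕 f)) : 𝓕⁻ (𝓕 f) =ᵐ[volume] f := by
  have hcont : Continuous (𝓕⁻ (𝓕 f)) := by
    rw [Real.fourierInv_eq_fourier_comp_neg]
    exact VectorFourier.fourierIntegral_continuous Real.continuous_fourierChar
      (by exact continuous_inner) hf'.comp_neg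
  refine ae_eq_of_integral_contDiff_smul_eq hcont.locallyIntegrable hf.locallyIntegrable
    fun g hg hgc => ?_
  set φ : 𝓢(V, ℂ) := (hgc.comp_left (g := ((↑) : ℝ → ℂ)) rfl).toSchwartzMap
    (Complex.ofRealCLM.contDiff.comp hg) with hφ
  have hφg : ∀ x, φ x = (g x : ℂ) := fun x => rfl
  set ψ : 𝓢(V, ℂ) := 𝓕⁻ φ
  have hψ : 𝓕 (ψ : V → ℂ) = φ := by
    rw [← SchwartzMap.fourier_coe]
    simp [ψ]
  have hψ' : 𝓕⁻ (φ : V → ℂ) = ψ := by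
    rw [← SchwartzMap.fourierInv_coe]
  have key : ∀ F G : V → ℂ, Integrable F → Integrable G →
      ∫ x, 𝓕 F x • G x = ∫ x, F x • 𝓕 G x := by
    intro F G hF hG
    have := VectorFourier.integral_fourierIntegral_smul_eq_flip (μ := volume) (ν := volume)
      (L := innerₗ V) Real.continuous_fourierChar continuous_inner hF hG
    rwa [flip_innerₗ] at this
  have h1 := key (𝓕 f) (fun x => φ (-x)) hf' φ.integrable.comp_neg
  have h2 := key f ψ hf ψ.integrable
  have h3 : 𝓕 (fun x => φ (-x)) = ψ := by
    rw [← hψ', Real.fourierInv_eq_fourier_comp_neg]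
  have h4 : ∫ x, 𝓕 (𝓕 f) x • φ (-x) = ∫ x, 𝓕⁻ (𝓕 f) x • φ x := by
    rw [← integral_neg_eq_self]
    simp [Real.fourierInv_eq_fourier_neg]
  rw [h4, h3, h2, hψ] at h1
  simpa [hφg, mul_comm] using h1

instance isAddHaarMeasure_volume_Pd (d : ℕ) :
    (volume : Measure (Pd d)).IsAddHaarMeasure :=
  Measure.prod.instIsAddHaarMeasure volume volume

instance regular_volume_Pd (d : ℕ) : (volume : Measure (Pd d)).Regular :=
  Measure.Regular.of_sigmaCompactSpace_of_isLocallyFiniteMeasure _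

/-- Phase space as a Euclidean space. -/
abbrev EPd (d : ℕ) : Type := WithLp 2 (EuclideanSpace ℝ (Fin d) × EuclideanSpace ℝ (Fin d))

/-- The identification of the Euclidean phase space with `Pd`. -/
def toPd (d : ℕ) : EPd d ≃L[ℝ] Pd d :=
  (WithLp.prodContinuousLinearEquiv 2 ℝ _ _).trans
    ((EuclideanSpace.equiv (Fin d) ℝ).prodCongr (EuclideanSpace.equiv (Fin d) ℝ))

theorem measurePreserving_toPd (d : ℕ) : MeasurePreserving (toPd d) :=
  ((PiLp.volume_preserving_ofLp (Fin d)).prod (PiLp.volume_preserving_ofLp (Fin d))).comp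
    (WithLp.volume_preserving_ofLp _ _)

theorem measurableEmbedding_toPd (d : ℕ) : MeasurableEmbedding (toPd d) :=
  (toPd d).toHomeomorph.measurableEmbedding

theorem dotP_toPd {d : ℕ} (x y : EPd d) : dotP (toPd d x) (toPd d y) = inner ℝ x y := by
  simp [dotP, toPd, PiLp.inner_apply, mul_comm]

theorem normP_toPd {d : ℕ} (x : EPd d) : normP (toPd d x) = ‖x‖ := by
  simp [normP, toPd, WithLp.prod_norm_eq_of_L2, EuclideanSpace.norm_sq_eq]

theorem normP_add_le {d : ℕ} (u v : Pd d) : normP (u + v) ≤ normP u + normP v := by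
  obtain ⟨x, rfl⟩ := (toPd d).surjective u
  obtain ⟨y, rfl⟩ := (toPd d).surjective v
  rw [← map_add]
  simpa only [normP_toPd] using norm_add_le x y

theorem normP_nonneg {d : ℕ} (u : Pd d) : 0 ≤ normP u := Real.sqrt_nonneg _

theorem continuous_normP {d : ℕ} : Continuous (normP (d := d)) := by
  unfold normP
  fun_prop

theorem abs_dotP_le {d : ℕ} (u v : Pd d) : |dotP u v| ≤ normP u * normP v := by
  obtain ⟨x, rfl⟩ := (toPd d).surjective u
  obtain ⟨y, rfl⟩ := (toPd d).surjective v
  simpa only [normP_toPd, dotP_toPd] using abs_real_inner_le_norm x y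

/-- The symplectic rotation, for which `ς(w, v) = v · J w`. -/
def rotJ {d : ℕ} (w : Pd d) : Pd d := (w.2, -w.1)

theorem dotP_rotJ {d : ℕ} (v w : Pd d) : dotP v (rotJ w) = symp w v := by
  simp [dotP, rotJ, symp, mul_comm, sub_eq_add_neg]

theorem normP_rotJ {d : ℕ} (w : Pd d) : normP (rotJ w) = normP w := by
  simp [normP, rotJ, add_comm]

theorem abs_symp_le {d : ℕ} (w v : Pd d) : |symp w v| ≤ normP w * normP v := by
  rw [← dotP_rotJ, mul_comm, ← normP_rotJ w]
  exact abs_dotP_le _ _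

theorem symp_swap {d : ℕ} (w v : Pd d) : symp v w = -symp w v := by
  simp [symp, mul_comm]

theorem dotP_add_left {d : ℕ} (u v z : Pd d) : dotP (u + v) z = dotP u z + dotP v z := by
  simp [dotP, add_mul, Finset.sum_add_distrib]
  ring

theorem dotP_add_right {d : ℕ} (z u v : Pd d) : dotP z (u + v) = dotP z u + dotP z v := by
  simp [dotP, mul_add, Finset.sum_add_distrib]
  ring

theorem dotP_smul_left {d : ℕ} (c : ℝ) (u z : Pd d) : dotP (c • u) z = c * dotP u z := by
  simp [dotP, mul_assoc, Finset.mul_sum, mul_add]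

theorem dotP_smul_right {d : ℕ} (c : ℝ) (u z : Pd d) : dotP u (c • z) = c * dotP u z := by
  simp [dotP, mul_left_comm, Finset.mul_sum, mul_add]

theorem fourier_comp_toPd {d : ℕ} (a : Pd d → ℂ) (v : EPd d) :
    𝓕 (fun x => a (toPd d x)) v = fourierT a ((2 * π) • toPd d v) := by
  rw [Real.fourier_eq', fourierT,
    ← (measurePreserving_toPd d).integral_comp (measurableEmbedding_toPd d)]
  refine integral_congr_ae (.of_forall fun x => ?_)
  simp only [dotP_smul_left, dotP_toPd, smul_eq_mul, real_inner_comm v x]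
  congr 2
  push_cast
  ring

/-- The inverse Fourier transform on phase space. -/
def invFourierT {d : ℕ} (f : Pd d → ℂ) (z : Pd d) : ℂ :=
  (((2 * π) ^ (2 * d) : ℝ) : ℂ)⁻¹ * ∫ v, f v * Complex.exp (Complex.I * (dotP v z : ℝ))

theorem invFourierT_fourierT {d : ℕ} {a : Pd d → ℂ} (ha : Integrable a)
    (ha' : Integrable (fourierT a)) : invFourierT (fourierT a) =ᵐ[volume] a := by
  have hf : Integrable fun x => a (toPd d x) :=
    (measurePreserving_toPd d).integrable_comp_of_integrable ha
  have hF : 𝓕 (fun x => a (toPd d x)) = fun v => fourierT a ((2 * π) • toPd d v) :=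
    funext (fourier_comp_toPd a)
  have hf' : Integrable (𝓕 fun x => a (toPd d x)) := by
    rw [hF]
    exact (measurePreserving_toPd d).integrable_comp_of_integrable
      (g := fun v => fourierT a ((2 * π) • v)) (ha'.comp_smul (by positivity))
  have h := ae_fourierInv_fourier_eq hf hf'
  have h' : ∀ x, 𝓕⁻ (𝓕 fun x => a (toPd d x)) x = invFourierT (fourierT a) (toPd d x) := by
    intro x
    rw [Real.fourierInv_eq', hF, invFourierT]
    have h1 := Measure.integral_comp_smul_of_nonneg (volume : Measure (Pd d))
      (fun v => fourierT a v * Complex.exp (Complex.I * (dotP v (toPd d x) : ℝ))) (2 * π)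
      (hR := by positivity)
    rw [← (measurePreserving_toPd d).integral_comp (measurableEmbedding_toPd d)] at h1
    have h2 : Module.finrank ℝ (Pd d) = 2 * d := by simp [two_mul]
    rw [h2, Complex.real_smul, Complex.ofReal_inv] at h1
    rw [← h1]
    refine integral_congr_ae (.of_forall fun v => ?_)
    simp only [dotP_smul_left, dotP_toPd, smul_eq_mul]
    rw [mul_comm]
    congr 2
    push_cast
    ring
  have h'' : ∀ᵐ x, invFourierT (fourierT a) (toPd d x) = a (toPd d x) := by
    filter_upwards [h] with x hx
    rw [← h', hx]
  rw [← (measurePreserving_toPd d).map_eq]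
  exact ((measurableEmbedding_toPd d).ae_map_iff).2 h''

theorem norm_exp_neg_I_mul_dotP {d : ℕ} (w z : Pd d) :
    ‖Complex.exp (-(Complex.I * (dotP w z : ℝ)))‖ = 1 := by
  simp [Complex.norm_exp]

theorem continuous_fourierT {d : ℕ} {a : Pd d → ℂ} (ha : Integrable a) :
    Continuous (fourierT a) := by
  refine continuous_of_dominated (bound := fun z => ‖a z‖) (fun w => ?_) (fun w => ?_) ha.norm ?_
  · refine AEStronglyMeasurable.mul (Continuous.aestronglyMeasurable ?_) ha.aestronglyMeasurable
    unfold dotP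
    fun_prop
  · exact .of_forall fun z => by rw [norm_mul, norm_exp_neg_I_mul_dotP, one_mul]
  · refine .of_forall fun z => ?_
    unfold dotP
    fun_prop

theorem norm_fourierT_le {d : ℕ} (a : Pd d → ℂ) (w : Pd d) : ‖fourierT a w‖ ≤ ∫ z, ‖a z‖ := by
  refine (norm_integral_le_integral_norm _).trans_eq ?_
  simp_rw [norm_mul, norm_exp_neg_I_mul_dotP, one_mul]

theorem fourierT_congr_ae {d : ℕ} {a b : Pd d → ℂ} (h : a =ᵐ[volume] b) :
    fourierT a = fourierT b := by
  funext w
  refine integral_congr_ae ?_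
  filter_upwards [h] with z hz
  rw [hz]

theorem continuous_invFourierT {d : ℕ} {f : Pd d → ℂ} (hf : Integrable f) :
    Continuous (invFourierT f) := by
  refine continuous_const.mul (continuous_of_dominated (bound := fun z => ‖f z‖)
    (fun w => ?_) (fun w => ?_) hf.norm ?_)
  · refine hf.aestronglyMeasurable.mul (Continuous.aestronglyMeasurable ?_)
    unfold dotP
    fun_prop
  · exact .of_forall fun z => by simp [Complex.norm_exp]
  · refine .of_forall fun z => ?_
    unfold dotP
    fun_prop

theorem integral_exp_mul_comp_add {d : ℕ} (b : Pd d → ℂ) (ζ y : Pd d) :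
    ∫ z, Complex.exp (-(Complex.I * (dotP ζ z : ℝ))) * b (z + y) =
      Complex.exp (Complex.I * (dotP ζ y : ℝ)) * fourierT b ζ := by
  rw [fourierT, ← integral_add_right_eq_self
    (fun z => Complex.exp (-(Complex.I * (dotP ζ z : ℝ))) * b z) y, ← integral_const_mul]
  congr 1
  funext z
  rw [← mul_assoc, ← Complex.exp_add, dotP_add_right]
  congr 2
  push_cast
  ring

theorem integrable_mul_comp_sub {d : ℕ} {f g : Pd d → ℂ} (hf : Integrable f)
    (hg : Integrable g) : Integrable fun p : Pd d × Pd d => f p.1 * g (p.2 - p.1) :=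
  (hf.convolution_integrand (ContinuousLinearMap.mul ℂ ℂ) hg).swap

/-- The Moyal product as a superposition of modulated translates. -/
theorem moyal_eq_integral_translate {d : ℕ} (ℏ : ℝ) {a b : Pd d → ℂ}
    (ha : Integrable (fourierT a)) (hb : Integrable (fourierT b)) (z : Pd d) :
    moyal ℏ a b z = (((2 * π) ^ (2 * d) : ℝ) : ℂ)⁻¹ *
      ∫ w, fourierT a w * Complex.exp (Complex.I * (dotP w z : ℝ)) *
        invFourierT (fourierT b) (z + (ℏ / 2) • rotJ w) := by
  have hint : Integrable fun p : Pd d × Pd d => fourierT a p.1 * fourierT b (p.2 - p.1) *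
        Complex.exp (Complex.I * ℏ / 2 * (symp p.1 (p.2 - p.1) : ℝ)) *
        Complex.exp (Complex.I * (dotP p.2 z : ℝ)) := by
    have h := integrable_mul_comp_sub ha hb
    refine h.mono ((h.aestronglyMeasurable.mul (Continuous.aestronglyMeasurable ?_)).mul
      (Continuous.aestronglyMeasurable ?_)) (.of_forall fun p => ?_)
    · unfold symp
      fun_prop
    · unfold dotP
      fun_prop
    · simp [Complex.norm_exp]
  have hinner : ∀ w : Pd d, ∫ ζ, fourierT a w * fourierT b (ζ - w) *
        Complex.exp (Complex.I * ℏ / 2 * (symp w (ζ - w) : ℝ)) *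
        Complex.exp (Complex.I * (dotP ζ z : ℝ)) =
      (((2 * π) ^ (2 * d) : ℝ) : ℂ) * (fourierT a w * Complex.exp (Complex.I * (dotP w z : ℝ)) *
        invFourierT (fourierT b) (z + (ℏ / 2) • rotJ w)) := by
    intro w
    have h0 : (((2 * π) ^ (2 * d) : ℝ) : ℂ) ≠ 0 := by
      exact_mod_cast (by positivity : ((2 * π) ^ (2 * d) : ℝ) ≠ 0)
    rw [invFourierT, mul_left_comm, mul_inv_cancel_left₀ h0, ← integral_const_mul,
      ← integral_add_right_eq_self _ w]
    congr 1
    funext v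
    have e : Complex.exp (Complex.I * (dotP (v + w) z : ℝ)) *
        Complex.exp (Complex.I * ℏ / 2 * (symp w v : ℝ)) =
        Complex.exp (Complex.I * (dotP w z : ℝ)) *
          Complex.exp (Complex.I * (dotP v (z + (ℏ / 2) • rotJ w) : ℝ)) := by
      rw [← Complex.exp_add, ← Complex.exp_add, dotP_add_left, dotP_add_right, dotP_smul_right,
        dotP_rotJ]
      congr 1
      push_cast
      ring
    rw [add_sub_cancel_right]
    linear_combination (fourierT a w * fourierT b v) * e
  rw [moyal, Measure.volume_eq_prod, integral_prod _ hint]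
  simp only [hinner]
  rw [integral_const_mul, ← mul_assoc]
  congr 1
  have h1 : (((2 * π) ^ (4 * d) : ℝ) : ℂ) =
      (((2 * π) ^ (2 * d) : ℝ) : ℂ) * (((2 * π) ^ (2 * d) : ℝ) : ℂ) := by
    push_cast
    ring
  have h0 : (((2 * π) ^ (2 * d) : ℝ) : ℂ) ≠ 0 := by
    exact_mod_cast (by positivity : ((2 * π) ^ (2 * d) : ℝ) ≠ 0)
  rw [h1]
  field_simp

theorem integrable_modulated_translate {d : ℕ} (c : ℝ) {f g : Pd d → ℂ} (hf : Integrable f)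
    (hg : Integrable g) (hgc : Continuous g) :
    Integrable fun p : Pd d × Pd d =>
      f p.1 * Complex.exp (Complex.I * (dotP p.1 p.2 : ℝ)) * g (p.2 + c • rotJ p.1) := by
  have hm : AEStronglyMeasurable (fun p : Pd d × Pd d =>
      f p.1 * Complex.exp (Complex.I * (dotP p.1 p.2 : ℝ)) * g (p.2 + c • rotJ p.1)) := by
    refine (hf.aestronglyMeasurable.comp_fst.mul (Continuous.aestronglyMeasurable ?_)).mul
      (Continuous.aestronglyMeasurable (hgc.comp ?_))
    · unfold dotP
      fun_prop
    · unfold rotJ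
      fun_prop
  have hn : ∀ w z : Pd d, ‖f w * Complex.exp (Complex.I * (dotP w z : ℝ)) * g (z + c • rotJ w)‖ =
      ‖f w‖ * ‖g (z + c • rotJ w)‖ := by
    intro w z
    simp [Complex.norm_exp]
  refine (integrable_prod_iff hm).2 ⟨.of_forall fun w => ?_, ?_⟩
  · refine ((hg.comp_add_right (c • rotJ w)).const_mul (f w)).mono ?_ (.of_forall fun z => ?_)
    · have hexp : Continuous fun z : Pd d => Complex.exp (Complex.I * (dotP w z : ℝ)) := by
        unfold dotP
        fun_prop
      exact (hexp.aestronglyMeasurable.const_mul (f w)).mul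
        (hg.comp_add_right (c • rotJ w)).aestronglyMeasurable
    · simp only [hn, norm_mul, le_refl]
  · simp only [hn, integral_const_mul, integral_add_right_eq_self fun z => ‖g z‖]
    exact hf.norm.mul_const _

theorem integrable_moyal {d : ℕ} (ℏ : ℝ) {a b : Pd d → ℂ} (ha : Integrable (fourierT a))
    (hb : Integrable b) (hb' : Integrable (fourierT b)) : Integrable (moyal ℏ a b) := by
  have h := integrable_modulated_translate (ℏ / 2) ha
    (hb.congr (invFourierT_fourierT hb hb').symm) (continuous_invFourierT hb')
  rw [funext (moyal_eq_integral_translate ℏ ha hb')]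
  exact h.integral_prod_right.const_mul _

theorem fourierT_moyal {d : ℕ} (ℏ : ℝ) {a b : Pd d → ℂ} (ha : Integrable (fourierT a))
    (hb : Integrable b) (hb' : Integrable (fourierT b)) (ζ : Pd d) :
    fourierT (moyal ℏ a b) ζ = (((2 * π) ^ (2 * d) : ℝ) : ℂ)⁻¹ *
      ∫ w, fourierT a w * fourierT b (ζ - w) *
        Complex.exp (Complex.I * (ℏ / 2 * symp w (ζ - w) : ℝ)) := by
  have hae := invFourierT_fourierT hb hb'
  have h := integrable_modulated_translate (ℏ / 2) ha (hb.congr hae.symm)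
    (continuous_invFourierT hb')
  have h' : Integrable fun p : Pd d × Pd d => Complex.exp (-(Complex.I * (dotP ζ p.1 : ℝ))) *
      (fourierT a p.2 * Complex.exp (Complex.I * (dotP p.2 p.1 : ℝ)) *
        invFourierT (fourierT b) (p.1 + (ℏ / 2) • rotJ p.2)) := by
    refine h.swap.mono ((Continuous.aestronglyMeasurable ?_).mul h.swap.aestronglyMeasurable)
      (.of_forall fun p => ?_)
    · unfold dotP
      fun_prop
    · simp [Complex.norm_exp]
  rw [fourierT, funext (moyal_eq_integral_translate ℏ ha hb')]
  simp only [mul_left_comm _ ((((2 * π) ^ (2 * d) : ℝ) : ℂ)⁻¹)]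
  rw [integral_const_mul]
  congr 1
  simp only [← integral_const_mul]
  rw [integral_integral_swap h']
  congr 1
  funext w
  have htr := integral_exp_mul_comp_add (invFourierT (fourierT b)) (ζ - w) ((ℏ / 2) • rotJ w)
  rw [fourierT_congr_ae hae, dotP_smul_right, dotP_rotJ] at htr
  rw [mul_assoc, mul_comm (fourierT b _), ← htr, ← integral_const_mul]
  congr 1
  funext z
  have e : Complex.exp (-(Complex.I * (dotP ζ z : ℝ))) * Complex.exp (Complex.I * (dotP w z : ℝ)) =
      Complex.exp (-(Complex.I * (dotP (ζ - w) z : ℝ))) := by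
    rw [← Complex.exp_add, ← sub_add_cancel ζ w, dotP_add_left, add_sub_cancel_right]
    congr 1
    push_cast
    ring
  rw [← e]
  ring

theorem Anorm_eq_lintegral_enorm {d : ℕ} (t : ℝ) (a : Pd d → ℂ) :
    Anorm t a = ∫⁻ w, ‖fourierT a w‖ₑ * ENNReal.ofReal (Real.exp (t * normP w)) := by
  simp only [Anorm, ENNReal.ofReal_mul (norm_nonneg _), ofReal_norm]

theorem MemAs.integrable_fourierT {d : ℕ} {t : ℝ} (ht : 0 ≤ t) {a : Pd d → ℂ}
    (ha : MemAs t a) : Integrable (fourierT a) := by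
  refine ⟨(continuous_fourierT ha.1).aestronglyMeasurable, lt_of_le_of_lt ?_ ha.2⟩
  rw [Anorm_eq_lintegral_enorm]
  refine lintegral_mono fun w => le_mul_of_one_le_right' ?_
  rw [ENNReal.one_le_ofReal]
  exact Real.one_le_exp (mul_nonneg ht (normP_nonneg w))

theorem fourierT_sub {d : ℕ} {a b : Pd d → ℂ} (ha : Integrable a) (hb : Integrable b)
    (w : Pd d) : fourierT (fun z => a z - b z) w = fourierT a w - fourierT b w := by
  have h : ∀ {c : Pd d → ℂ}, Integrable c →
      Integrable fun z => Complex.exp (-(Complex.I * (dotP w z : ℝ))) * c z := by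
    intro c hc
    refine hc.mono ((Continuous.aestronglyMeasurable ?_).mul hc.aestronglyMeasurable)
      (.of_forall fun z => ?_)
    · unfold dotP
      fun_prop
    · rw [norm_mul, norm_exp_neg_I_mul_dotP, one_mul]
  rw [fourierT, fourierT, fourierT, ← integral_sub (h ha) (h hb)]
  simp only [mul_sub]

/-- The twisted convolution formula for the Fourier transform of the Moyal commutator. -/
theorem fourierT_moyalComm {d : ℕ} (ℏ : ℝ) {a b : Pd d → ℂ} (ha : Integrable a)
    (ha' : Integrable (fourierT a)) (hb : Integrable b) (hb' : Integrable (fourierT b))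
    (ζ : Pd d) :
    fourierT (moyalComm ℏ a b) ζ = (((2 * π) ^ (2 * d) : ℝ) : ℂ)⁻¹ *
      ∫ w, fourierT a w * fourierT b (ζ - w) *
        (Complex.exp (Complex.I * (ℏ / 2 * symp w (ζ - w) : ℝ)) -
          Complex.exp (Complex.I * (-(ℏ / 2 * symp w (ζ - w)) : ℝ))) := by
  have hint : ∀ φ : Pd d → ℝ, Continuous φ →
      Integrable fun w => fourierT a w * fourierT b (ζ - w) *
        Complex.exp (Complex.I * (φ w : ℝ)) := by
    intro φ hφ
    have hbc : Continuous fun w => fourierT b (ζ - w) :=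
      (continuous_fourierT hb).comp (by fun_prop)
    refine (ha'.norm.mul_const (∫ z, ‖b z‖)).mono' ?_ (.of_forall fun w => ?_)
    · exact (ha'.aestronglyMeasurable.mul hbc.aestronglyMeasurable).mul
        (Continuous.aestronglyMeasurable (by fun_prop))
    · rw [norm_mul, norm_mul, Complex.norm_exp_I_mul_ofReal, mul_one]
      exact mul_le_mul_of_nonneg_left (norm_fourierT_le b _) (norm_nonneg _)
  have hsymp : Continuous fun w : Pd d => ℏ / 2 * symp w (ζ - w) := by
    unfold symp
    fun_prop
  have hba : ∫ w, fourierT b w * fourierT a (ζ - w) *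
        Complex.exp (Complex.I * (ℏ / 2 * symp w (ζ - w) : ℝ)) =
      ∫ w, fourierT a w * fourierT b (ζ - w) *
        Complex.exp (Complex.I * (-(ℏ / 2 * symp w (ζ - w)) : ℝ)) := by
    rw [← integral_sub_left_eq_self _ volume ζ]
    congr 1
    funext w
    rw [sub_sub_cancel, symp_swap w, mul_neg, mul_comm (fourierT b _)]
  unfold moyalComm
  rw [fourierT_sub (integrable_moyal ℏ ha' hb hb') (integrable_moyal ℏ hb' ha ha'),
    fourierT_moyal ℏ ha' hb hb', fourierT_moyal ℏ hb' ha ha', hba, ← mul_sub,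
    ← integral_sub (hint _ hsymp) (hint (fun w => -(ℏ / 2 * symp w (ζ - w))) hsymp.neg)]
  simp only [mul_sub]

theorem norm_exp_sub_exp_neg_le (θ : ℝ) :
    ‖Complex.exp (Complex.I * (θ : ℝ)) - Complex.exp (Complex.I * (-θ : ℝ))‖ ≤ 2 * |θ| := by
  have h1 := Real.norm_exp_I_mul_ofReal_sub_one_le (x := θ)
  have h2 := Real.norm_exp_I_mul_ofReal_sub_one_le (x := -θ)
  have h3 := norm_sub_le (Complex.exp (Complex.I * (θ : ℝ)) - 1)
    (Complex.exp (Complex.I * (-θ : ℝ)) - 1)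
  rw [sub_sub_sub_cancel_right] at h3
  rw [Real.norm_eq_abs] at h1 h2
  rw [abs_neg] at h2
  linarith

theorem enorm_fourierT_moyalComm_le {d : ℕ} {ℏ : ℝ} (hℏ : 0 < ℏ) {a b : Pd d → ℂ}
    (ha : Integrable a) (ha' : Integrable (fourierT a)) (hb : Integrable b)
    (hb' : Integrable (fourierT b)) (ζ : Pd d) :
    ‖fourierT (moyalComm ℏ a b) ζ‖ₑ ≤ ENNReal.ofReal ℏ *
      ∫⁻ w, ‖fourierT a w‖ₑ * ENNReal.ofReal (normP w) *
        (‖fourierT b (ζ - w)‖ₑ * ENNReal.ofReal (normP (ζ - w))) := by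
  rw [fourierT_moyalComm ℏ ha ha' hb hb', enorm_mul]
  have hc : ‖(((2 * π) ^ (2 * d) : ℝ) : ℂ)⁻¹‖ₑ ≤ 1 := by
    rw [← ofReal_norm, ENNReal.ofReal_le_one, norm_inv, Complex.norm_real,
      Real.norm_of_nonneg (by positivity)]
    exact inv_le_one_of_one_le₀ (one_le_pow₀ (by linarith [Real.two_le_pi]))
  refine (mul_le_mul' hc (enorm_integral_le_lintegral_enorm _)).trans ?_
  rw [one_mul, ← lintegral_const_mul' _ _ ENNReal.ofReal_ne_top]
  refine lintegral_mono fun w => ?_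
  simp only [← ofReal_norm]
  rw [← ENNReal.ofReal_mul (norm_nonneg _), ← ENNReal.ofReal_mul (norm_nonneg _),
    ← ENNReal.ofReal_mul (mul_nonneg (norm_nonneg _) (normP_nonneg _)),
    ← ENNReal.ofReal_mul hℏ.le]
  refine ENNReal.ofReal_le_ofReal ?_
  rw [norm_mul, norm_mul]
  have h1 := norm_exp_sub_exp_neg_le (ℏ / 2 * symp w (ζ - w))
  have h2 : 2 * |ℏ / 2 * symp w (ζ - w)| ≤ ℏ * (normP w * normP (ζ - w)) := by
    rw [abs_mul, abs_of_pos (by positivity : 0 < ℏ / 2)]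
    have := mul_le_mul_of_nonneg_left (abs_symp_le w (ζ - w)) hℏ.le
    linarith
  calc _ ≤ ‖fourierT a w‖ * ‖fourierT b (ζ - w)‖ * (ℏ * (normP w * normP (ζ - w))) := by
        gcongr
        exact h1.trans h2
    _ = _ := by ring

theorem mul_exp_le {t δ x : ℝ} (hδ : 0 < δ) :
    x * Real.exp (t * x) ≤ (Real.exp 1 * δ)⁻¹ * Real.exp ((t + δ) * x) := by
  have h : δ * x * Real.exp 1 ≤ Real.exp (δ * x) := by
    have h1 := Real.add_one_le_exp (δ * x - 1)
    rw [sub_add_cancel, Real.exp_sub, le_div_iff₀ (Real.exp_pos 1)] at h1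
    exact h1
  rw [add_mul, Real.exp_add, inv_mul_eq_div, le_div_iff₀ (by positivity)]
  calc x * Real.exp (t * x) * (Real.exp 1 * δ)
      = Real.exp (t * x) * (δ * x * Real.exp 1) := by ring
    _ ≤ _ := by gcongr

theorem lintegral_enorm_mul_normP_mul_exp_le {d : ℕ} (t : ℝ) {δ : ℝ} (hδ : 0 < δ)
    (a : Pd d → ℂ) :
    ∫⁻ w, ‖fourierT a w‖ₑ * ENNReal.ofReal (normP w) * ENNReal.ofReal (Real.exp (t * normP w)) ≤
      ENNReal.ofReal (Real.exp 1 * δ)⁻¹ * Anorm (t + δ) a := by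
  rw [Anorm_eq_lintegral_enorm, ← lintegral_const_mul' _ _ ENNReal.ofReal_ne_top]
  refine lintegral_mono fun w => ?_
  simp only
  rw [mul_assoc, mul_left_comm (ENNReal.ofReal _⁻¹), ← ENNReal.ofReal_mul (normP_nonneg w),
    ← ENNReal.ofReal_mul (by positivity)]
  exact mul_le_mul_right (ENNReal.ofReal_le_ofReal (mul_exp_le hδ)) _

theorem Anorm_moyalComm_le_mul_lintegral {d : ℕ} {ℏ t : ℝ} (hℏ : 0 < ℏ) (ht : 0 ≤ t)
    {a b : Pd d → ℂ} (ha : Integrable a) (ha' : Integrable (fourierT a)) (hb : Integrable b)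
    (hb' : Integrable (fourierT b)) :
    Anorm t (moyalComm ℏ a b) ≤ ENNReal.ofReal ℏ *
      ((∫⁻ w, ‖fourierT a w‖ₑ * ENNReal.ofReal (normP w) *
          ENNReal.ofReal (Real.exp (t * normP w))) *
        ∫⁻ w, ‖fourierT b w‖ₑ * ENNReal.ofReal (normP w) *
          ENNReal.ofReal (Real.exp (t * normP w))) := by
  have hmeas : ∀ {c : Pd d → ℂ}, Integrable c → Measurable fun w =>
      ‖fourierT c w‖ₑ * ENNReal.ofReal (normP w) * ENNReal.ofReal (Real.exp (t * normP w)) := by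
    intro c hc
    have h1 : Measurable fun w => ‖fourierT c w‖ₑ := (continuous_fourierT hc).measurable.enorm
    have h2 : Measurable (normP (d := d)) := continuous_normP.measurable
    fun_prop
  set A : Pd d → ℝ≥0∞ := fun w =>
    ‖fourierT a w‖ₑ * ENNReal.ofReal (normP w) * ENNReal.ofReal (Real.exp (t * normP w)) with hA
  set B : Pd d → ℝ≥0∞ := fun w =>
    ‖fourierT b w‖ₑ * ENNReal.ofReal (normP w) * ENNReal.ofReal (Real.exp (t * normP w)) with hB
  have hAm : Measurable A := hmeas ha
  have hBm : Measurable B := hmeas hb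
  have hpt : ∀ ζ, ‖fourierT (moyalComm ℏ a b) ζ‖ₑ * ENNReal.ofReal (Real.exp (t * normP ζ)) ≤
      ENNReal.ofReal ℏ * ∫⁻ w, A w * B (ζ - w) := by
    intro ζ
    refine (mul_le_mul_left (enorm_fourierT_moyalComm_le hℏ ha ha' hb hb' ζ) _).trans ?_
    rw [mul_assoc, ← lintegral_mul_const' _ _ ENNReal.ofReal_ne_top]
    refine mul_le_mul_right (lintegral_mono fun w => ?_) _
    have hexp : ENNReal.ofReal (Real.exp (t * normP ζ)) ≤
        ENNReal.ofReal (Real.exp (t * normP w)) *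
          ENNReal.ofReal (Real.exp (t * normP (ζ - w))) := by
      rw [← ENNReal.ofReal_mul (Real.exp_pos _).le, ← Real.exp_add, ← mul_add]
      have := normP_add_le w (ζ - w)
      rw [add_sub_cancel] at this
      gcongr
    refine (mul_le_mul_right hexp _).trans_eq ?_
    simp only [hA, hB]
    ring
  rw [Anorm_eq_lintegral_enorm]
  refine (lintegral_mono hpt).trans_eq ?_
  rw [lintegral_const_mul' _ _ ENNReal.ofReal_ne_top]
  congr 1
  rw [lintegral_lintegral_swap (by fun_prop), ← lintegral_mul_const _ hAm]
  congr 1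
  funext w
  rw [lintegral_const_mul _ (by fun_prop), lintegral_sub_right_eq_self]

/-- The commutator estimate with losses of analyticity `δ` and `δ'` on the two factors. -/
theorem Anorm_moyalComm_le {d : ℕ} {ℏ t δ δ' : ℝ} (hℏ : 0 < ℏ) (ht : 0 ≤ t) (hδ : 0 < δ)
    (hδ' : 0 < δ') {a b : Pd d → ℂ} (ha : MemAs (t + δ) a) (hb : MemAs (t + δ') b) :
    Anorm t (moyalComm ℏ a b) ≤
      ENNReal.ofReal (ℏ * ((Real.exp 1 * δ)⁻¹ * (Real.exp 1 * δ')⁻¹)) *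
        (Anorm (t + δ) a * Anorm (t + δ') b) := by
  refine (Anorm_moyalComm_le_mul_lintegral hℏ ht ha.1 (ha.integrable_fourierT (by positivity))
    hb.1 (hb.integrable_fourierT (by positivity))).trans ?_
  rw [ENNReal.ofReal_mul hℏ.le, ENNReal.ofReal_mul (by positivity), mul_assoc,
    mul_mul_mul_comm]
  gcongr
  · exact lintegral_enorm_mul_normP_mul_exp_le t hδ a
  · exact lintegral_enorm_mul_normP_mul_exp_le t hδ' b

theorem integrable_moyalComm {d : ℕ} (ℏ : ℝ) {a b : Pd d → ℂ} (ha : Integrable a)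
    (ha' : Integrable (fourierT a)) (hb : Integrable b) (hb' : Integrable (fourierT b)) :
    Integrable (moyalComm ℏ a b) :=
  (integrable_moyal ℏ ha' hb hb').sub (integrable_moyal ℏ hb' ha ha')

theorem MemAs.moyalComm {d : ℕ} {ℏ t δ δ' : ℝ} (hℏ : 0 < ℏ) (ht : 0 ≤ t) (hδ : 0 < δ)
    (hδ' : 0 < δ') {a b : Pd d → ℂ} (ha : MemAs (t + δ) a) (hb : MemAs (t + δ') b) :
    MemAs t (moyalComm ℏ a b) :=
  ⟨integrable_moyalComm ℏ ha.1 (ha.integrable_fourierT (by positivity))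
    hb.1 (hb.integrable_fourierT (by positivity)),
    (Anorm_moyalComm_le hℏ ht hδ hδ' ha hb).trans_lt
      (ENNReal.mul_lt_top ENNReal.ofReal_lt_top (ENNReal.mul_lt_top ha.2 hb.2))⟩

/-- The bound for the `k`-th iterated commutator when each step loses a strip of width `δ`. -/
theorem memAs_adM_and_Anorm_adM_le {d : ℕ} {s δ ℏ : ℝ} (hδ : 0 < δ) (hℏ : 0 < ℏ)
    {a G : Pd d → ℂ} (ha : MemAs s a) (hG : MemAs s G) (k : ℕ) (hk : k * δ ≤ s) :
    MemAs (s - k * δ) (adM ℏ G k a) ∧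
      Anorm (s - k * δ) (adM ℏ G k a) ≤
        ENNReal.ofReal ((ℏ / (Real.exp 1 * δ) ^ 2) ^ k / (k.factorial : ℝ)) *
          Anorm s a * Anorm s G ^ k := by
  induction k with
  | zero => simpa [adM] using ha
  | succ k ih =>
    push_cast at hk ⊢
    obtain ⟨hmem, hle⟩ := ih (by linarith)
    have ht : 0 ≤ s - (k + 1) * δ := by linarith
    have hG' : MemAs (s - (k + 1) * δ + (k + 1) * δ) G := by rwa [sub_add_cancel]
    have hδk : s - (k + 1) * δ + δ = s - k * δ := by ring
    have hmem' : MemAs (s - (k + 1) * δ + δ) (adM ℏ G k a) := by rwa [hδk]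
    have hpos : 0 < (k + 1) * δ := by positivity
    refine ⟨hG'.moyalComm hℏ ht hpos hδ hmem',
      (Anorm_moyalComm_le hℏ ht hpos hδ hG' hmem').trans ?_⟩
    rw [sub_add_cancel, hδk]
    refine (mul_le_mul_right (mul_le_mul_right hle _) _).trans_eq ?_
    have hfac : (ℏ / (Real.exp 1 * δ) ^ 2) ^ (k + 1) / ((k + 1).factorial : ℝ) =
        ℏ * ((Real.exp 1 * ((k + 1) * δ))⁻¹ * (Real.exp 1 * δ)⁻¹) *
          ((ℏ / (Real.exp 1 * δ) ^ 2) ^ k / (k.factorial : ℝ)) := by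
      rw [Nat.factorial_succ, pow_succ]
      push_cast
      field_simp
    rw [hfac, ENNReal.ofReal_mul
      (p := ℏ * ((Real.exp 1 * ((k + 1) * δ))⁻¹ * (Real.exp 1 * δ)⁻¹)) (by positivity)]
    ring

/-- Bound on the iterated Moyal commutators:
‖Ad_G^{♯ℏ,j}(a)‖_{s−σ} ≤ (2^j ℏ^j j^{2j}/(e^{2j} σ^{2j} j!)) ‖a‖_s ‖G‖_s^j for j ≥ 1. -/
theorem adM_bound {d : ℕ} (s σ ℏ : ℝ) (hs : 0 < s) (hσ : 0 < σ) (hσs : σ < s)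
    (hℏ : 0 < ℏ) (a G : Pd d → ℂ) (ha : MemAs s a) (hG : MemAs s G) :
    ∀ j : ℕ, 1 ≤ j →
      MemAs (s - σ) (adM ℏ G j a) ∧
        Anorm (s - σ) (adM ℏ G j a) ≤
          ENNReal.ofReal
              (2 ^ j * ℏ ^ j * (j : ℝ) ^ (2 * j) /
                (Real.exp 1 ^ (2 * j) * σ ^ (2 * j) * (j.factorial : ℝ))) *
            Anorm s a * Anorm s G ^ j := by
  intro j hj
  have hj0 : (0 : ℝ) < j := by exact_mod_cast hj
  have hjσ : j * (σ / j) = σ := mul_div_cancel₀ σ hj0.ne'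
  obtain ⟨hmem, hle⟩ := memAs_adM_and_Anorm_adM_le (δ := σ / j) (by positivity) hℏ ha hG j
    (by rw [hjσ]; exact hσs.le)
  rw [hjσ] at hmem hle
  refine ⟨hmem, hle.trans ?_⟩
  refine mul_le_mul_left (mul_le_mul_left (ENNReal.ofReal_le_ofReal ?_) _) _
  have hpow : (1 : ℝ) ≤ 2 ^ j := one_le_pow₀ one_le_two
  calc (ℏ / (Real.exp 1 * (σ / j)) ^ 2) ^ j / (j.factorial : ℝ)
      = 1 * (ℏ ^ j * (j : ℝ) ^ (2 * j) /
          (Real.exp 1 ^ (2 * j) * σ ^ (2 * j) * (j.factorial : ℝ))) := by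
        simp only [pow_mul, ← mul_pow, ← div_pow, one_mul, ← div_div]
        congr 2
        field_simp
    _ ≤ 2 ^ j * (ℏ ^ j * (j : ℝ) ^ (2 * j) /
          (Real.exp 1 ^ (2 * j) * σ ^ (2 * j) * (j.factorial : ℝ))) := by gcongr
    _ = _ := by ring

end
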